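/- For all smooth φ, ψ, χ : U → ℂ the third-order associativity identity holds on U: C̃₃(φ,ψ)·χ + C₂(C₁(φ,ψ), χ) + C₁(C₂(φ,ψ), χ) + C̃₃(φ·ψ, χ) = φ·C̃₃(ψ,χ) + C₂(φ, C₁(ψ,χ)) + C₁(φ, C₂(ψ,χ)) + C̃₃(φ, ψ·χ). -/

import Mathlib

open scoped BigOperators

noncomputable section


/-- The `k`-th standard basis vector of `ℂⁿ`. -/
def ebasis (n : ℕ) (k : Fin n) : Fin n → ℂ := Pi.single k 1

/-- The holomorphic Wirtinger derivative `∂ₖ f`, computed via the real Fréchet derivative: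
`∂ₖ f (z) = (1/2) (Df(z)(eₖ) - i · Df(z)(i·eₖ))`. -/
def wdP (n : ℕ) (k : Fin n) (f : (Fin n → ℂ) → ℂ) : (Fin n → ℂ) → ℂ :=
  fun z => (1 / 2 : ℂ) *
    (fderiv ℝ f z (ebasis n k) - Complex.I * fderiv ℝ f z (Complex.I • ebasis n k))

/-- The antiholomorphic Wirtinger derivative `∂̄ₖ f`:
`∂̄ₖ f (z) = (1/2) (Df(z)(eₖ) + i · Df(z)(i·eₖ))`. -/
def wdB (n : ℕ) (k : Fin n) (f : (Fin n → ℂ) → ℂ) : (Fin n → ℂ) → ℂ :=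
  fun z => (1 / 2 : ℂ) *
    (fderiv ℝ f z (ebasis n k) + Complex.I * fderiv ℝ f z (Complex.I • ebasis n k))

/-- The Kähler potential viewed as a complex valued function. -/
def Phic (n : ℕ) (Φ : (Fin n → ℂ) → ℝ) : (Fin n → ℂ) → ℂ := fun z => (Φ z : ℂ)

/-- The metric `g_{k l̄} = ∂_k ∂̄_l Φ`. -/
def gdn (n : ℕ) (Φ : (Fin n → ℂ) → ℝ) (k l : Fin n) : (Fin n → ℂ) → ℂ :=
  wdP n k (wdB n l (Phic n Φ))

/-- `g_{k p t̄} = ∂_k ∂_p ∂̄_t Φ`. -/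
def g3h (n : ℕ) (Φ : (Fin n → ℂ) → ℝ) (k p t : Fin n) : (Fin n → ℂ) → ℂ :=
  wdP n k (wdP n p (wdB n t (Phic n Φ)))

/-- `g_{s q̄ l̄} = ∂_s ∂̄_q ∂̄_l Φ`. -/
def g3a (n : ℕ) (Φ : (Fin n → ℂ) → ℝ) (s q l : Fin n) : (Fin n → ℂ) → ℂ :=
  wdP n s (wdB n q (wdB n l (Phic n Φ)))

/-- `g_{a b̄ k l̄} = ∂_a ∂_k ∂̄_b ∂̄_l Φ`. -/
def g4 (n : ℕ) (Φ : (Fin n → ℂ) → ℝ) (a b k l : Fin n) : (Fin n → ℂ) → ℂ :=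
  wdP n a (wdP n k (wdB n b (wdB n l (Phic n Φ))))

/-- Christoffel symbol `Γ^s_{kp} = Σ_t g_{k p t̄} g^{t̄ s}`. -/
def GamH (n : ℕ) (Φ : (Fin n → ℂ) → ℝ) (ginv : Fin n → Fin n → (Fin n → ℂ) → ℂ)
    (s k p : Fin n) : (Fin n → ℂ) → ℂ :=
  fun z => ∑ t, g3h n Φ k p t z * ginv t s z

/-- Christoffel symbol `Γ^t̄_{l̄ q̄} = Σ_s g^{t̄ s} g_{s q̄ l̄}`. -/
def GamB (n : ℕ) (Φ : (Fin n → ℂ) → ℝ) (ginv : Fin n → Fin n → (Fin n → ℂ) → ℂ)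
    (t l q : Fin n) : (Fin n → ℂ) → ℂ :=
  fun z => ∑ s, ginv t s z * g3a n Φ s q l z

/-- Covariant derivative `ψ_{/kp} = ∂_p ψ_{/k} - Σ_s Γ^s_{pk} ψ_{/s}`. -/
def cdH2 (n : ℕ) (Φ : (Fin n → ℂ) → ℝ) (ginv : Fin n → Fin n → (Fin n → ℂ) → ℂ)
    (ψ : (Fin n → ℂ) → ℂ) (k p : Fin n) : (Fin n → ℂ) → ℂ :=
  fun z => wdP n p (wdP n k ψ) z - ∑ s, GamH n Φ ginv s p k z * wdP n s ψ z

/-- Covariant derivative `ψ_{/kps} = ∂_s ψ_{/kp} - Σ_a Γ^a_{sk} ψ_{/ap} - Σ_a Γ^a_{sp} ψ_{/ka}`. -/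
def cdH3 (n : ℕ) (Φ : (Fin n → ℂ) → ℝ) (ginv : Fin n → Fin n → (Fin n → ℂ) → ℂ)
    (ψ : (Fin n → ℂ) → ℂ) (k p s : Fin n) : (Fin n → ℂ) → ℂ :=
  fun z => wdP n s (cdH2 n Φ ginv ψ k p) z
    - ∑ a, GamH n Φ ginv a s k z * cdH2 n Φ ginv ψ a p z
    - ∑ a, GamH n Φ ginv a s p z * cdH2 n Φ ginv ψ k a z

/-- Covariant derivative `φ_{/l̄q̄} = ∂̄_q φ_{/l̄} - Σ_t Γ^t̄_{q̄l̄} φ_{/t̄}`. -/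
def cdB2 (n : ℕ) (Φ : (Fin n → ℂ) → ℝ) (ginv : Fin n → Fin n → (Fin n → ℂ) → ℂ)
    (φ : (Fin n → ℂ) → ℂ) (l q : Fin n) : (Fin n → ℂ) → ℂ :=
  fun z => wdB n q (wdB n l φ) z - ∑ t, GamB n Φ ginv t q l z * wdB n t φ z

/-- Covariant derivative `φ_{/l̄q̄t̄} = ∂̄_t φ_{/l̄q̄} - Σ_a Γ^ā_{t̄l̄} φ_{/āq̄} - Σ_a Γ^ā_{t̄q̄} φ_{/l̄ā}`. -/
def cdB3 (n : ℕ) (Φ : (Fin n → ℂ) → ℝ) (ginv : Fin n → Fin n → (Fin n → ℂ) → ℂ)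
    (φ : (Fin n → ℂ) → ℂ) (l q t : Fin n) : (Fin n → ℂ) → ℂ :=
  fun z => wdB n t (cdB2 n Φ ginv φ l q) z
    - ∑ a, GamB n Φ ginv a t l z * cdB2 n Φ ginv φ a q z
    - ∑ a, GamB n Φ ginv a t q z * cdB2 n Φ ginv φ l a z

/-- The curvature `R^{q̄p}_{k l̄} = ∂_k ∂̄_l g^{q̄p} - Σ_{m,n} (∂̄_l g^{q̄m})(∂_k g^{n̄p}) g_{m n̄}`. -/
def Rcur (n : ℕ) (Φ : (Fin n → ℂ) → ℝ) (ginv : Fin n → Fin n → (Fin n → ℂ) → ℂ)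
    (q p k l : Fin n) : (Fin n → ℂ) → ℂ :=
  fun z => wdP n k (wdB n l (ginv q p)) z
    - ∑ m, ∑ m', wdB n l (ginv q m) z * wdP n k (ginv m' p) z * gdn n Φ m m' z

/-- `R^{l̄ k q̄ p} = Σ_{a,b} g^{l̄ a} g^{b̄ k} R^{q̄p}_{a b̄}`. -/
def Rup4 (n : ℕ) (Φ : (Fin n → ℂ) → ℝ) (ginv : Fin n → Fin n → (Fin n → ℂ) → ℂ)
    (l k q p : Fin n) : (Fin n → ℂ) → ℂ :=
  fun z => ∑ a, ∑ b, ginv l a z * ginv b k z * Rcur n Φ ginv q p a b z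

/-- `C₁(φ,ψ) = Σ g^{l̄k} (∂̄_l φ)(∂_k ψ)`. -/
def C1op (n : ℕ) (ginv : Fin n → Fin n → (Fin n → ℂ) → ℂ)
    (φ ψ : (Fin n → ℂ) → ℂ) : (Fin n → ℂ) → ℂ :=
  fun z => ∑ l, ∑ k, ginv l k z * wdB n l φ z * wdP n k ψ z

/-- `C₂(φ,ψ) = (1/2) Σ g^{l̄k} g^{q̄p} φ_{/l̄q̄} ψ_{/kp}`. -/
def C2op (n : ℕ) (Φ : (Fin n → ℂ) → ℝ) (ginv : Fin n → Fin n → (Fin n → ℂ) → ℂ)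
    (φ ψ : (Fin n → ℂ) → ℂ) : (Fin n → ℂ) → ℂ :=
  fun z => (1 / 2 : ℂ) * ∑ l, ∑ k, ∑ q, ∑ p,
    ginv l k z * ginv q p z * cdB2 n Φ ginv φ l q z * cdH2 n Φ ginv ψ k p z

/-- `C̃₃(φ,ψ) = (1/6) Σ g^{l̄k} g^{q̄p} g^{t̄s} φ_{/l̄q̄t̄} ψ_{/kps}
  + (1/4) Σ R^{l̄kq̄p} φ_{/l̄q̄} ψ_{/kp}
  + (1/12) Σ g^{n̄m} R^{l̄p}_{mq̄} R^{q̄k}_{pn̄} φ_{/l̄} ψ_{/k}`. -/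
def C3top (n : ℕ) (Φ : (Fin n → ℂ) → ℝ) (ginv : Fin n → Fin n → (Fin n → ℂ) → ℂ)
    (φ ψ : (Fin n → ℂ) → ℂ) : (Fin n → ℂ) → ℂ :=
  fun z =>
    (1 / 6 : ℂ) * (∑ l, ∑ k, ∑ q, ∑ p, ∑ t, ∑ s,
        ginv l k z * ginv q p z * ginv t s z *
          cdB3 n Φ ginv φ l q t z * cdH3 n Φ ginv ψ k p s z)
    + (1 / 4 : ℂ) * (∑ l, ∑ k, ∑ q, ∑ p,
        Rup4 n Φ ginv l k q p z * cdB2 n Φ ginv φ l q z * cdH2 n Φ ginv ψ k p z)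
    + (1 / 12 : ℂ) * (∑ l, ∑ k, (∑ m, ∑ m', ∑ p, ∑ q,
        ginv m' m z * Rcur n Φ ginv l p m q z * Rcur n Φ ginv q k p m' z) *
          wdB n l φ z * wdP n k ψ z)

section Half

set_option linter.unusedSectionVars false

variable {ι : Type} [Fintype ι] [DecidableEq ι] {A : Type} [CommRing A] [Algebra ℂ A]

def gamA (D : ι → Derivation ℂ A A) (h g : ι → ι → A) (b q l : ι) : A :=
  ∑ s, h b s * D q (g s l)

def cov2 (D : ι → Derivation ℂ A A) (Γ : ι → ι → ι → A) (φ : A) (l q : ι) : A :=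
  D q (D l φ) - ∑ t, Γ t q l * D t φ

def cov3 (D : ι → Derivation ℂ A A) (Γ : ι → ι → ι → A) (φ : A) (l q t : ι) : A :=
  D t (cov2 D Γ φ l q) - ∑ a, Γ a t l * cov2 D Γ φ a q - ∑ a, Γ a t q * cov2 D Γ φ l a

theorem D_mul (D : Derivation ℂ A A) (a b : A) : D (a * b) = D a * b + a * D b := by
  rw [Derivation.leibniz, smul_eq_mul, smul_eq_mul]; ring

theorem D_inv (D : Derivation ℂ A A) (h g : ι → ι → A)
    (hg : ∀ l q, ∑ k, h l k * g k q = if l = q then 1 else 0)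
    (gh : ∀ l q, ∑ k, g l k * h k q = if l = q then 1 else 0) (l m : ι) :
    D (h l m) = - ∑ a, (∑ s, h l s * D (g s a)) * h a m := by
  have key : ∀ q, ∑ k, D (h l k) * g k q = - ∑ k, h l k * D (g k q) := by
    intro q
    have := congrArg D (hg l q)
    have h0 : D (if l = q then (1 : A) else 0) = 0 := by split_ifs <;> simp
    rw [h0, map_sum] at this
    simp only [D_mul, Finset.sum_add_distrib] at this
    exact eq_neg_of_add_eq_zero_left this
  calc D (h l m) = ∑ k, D (h l k) * ∑ q, g k q * h q m := by simp [gh]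
    _ = ∑ q, (∑ k, D (h l k) * g k q) * h q m := by
        simp only [Finset.mul_sum, Finset.sum_mul]
        rw [Finset.sum_comm]
        simp only [mul_assoc]
    _ = _ := by simp only [key, neg_mul, Finset.sum_neg_distrib]

variable (D : ι → Derivation ℂ A A) (h : ι → ι → A) (Γ : ι → ι → ι → A)

theorem D_contr (hΓ : ∀ q l k, D q (h l k) = - ∑ a, Γ l q a * h a k) (Z : ι → ι → A) (q : ι) :
    D q (∑ t, ∑ s, h t s * Z t s)
      = ∑ t, ∑ s, h t s * (D q (Z t s) - ∑ a, Γ a q t * Z a s) := by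
  simp only [map_sum, D_mul, hΓ, mul_sub, Finset.sum_add_distrib, Finset.sum_sub_distrib]
  have : ∑ t, ∑ s, (-∑ a, Γ t q a * h a s) * Z t s = - ∑ t, ∑ s, h t s * ∑ a, Γ a q t * Z a s := by
    simp only [neg_mul, Finset.sum_neg_distrib, Finset.sum_mul, Finset.mul_sum]
    congr 1
    calc _ = ∑ t, ∑ a, ∑ s, Γ t q a * h a s * Z t s :=
          Finset.sum_congr rfl fun _ _ => Finset.sum_comm
      _ = ∑ a, ∑ t, ∑ s, Γ t q a * h a s * Z t s := Finset.sum_comm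
      _ = ∑ a, ∑ s, ∑ t, Γ t q a * h a s * Z t s :=
          Finset.sum_congr rfl fun _ _ => Finset.sum_comm
      _ = _ := by
          refine Finset.sum_congr rfl fun _ _ => Finset.sum_congr rfl fun _ _ =>
            Finset.sum_congr rfl fun _ _ => by ring
  rw [this]; ring

theorem cov2_symm (hD : ∀ i j f, D i (D j f) = D j (D i f)) (hs : ∀ a l q, Γ a l q = Γ a q l)
    (φ : A) (l q : ι) : cov2 D Γ φ l q = cov2 D Γ φ q l := by
  unfold cov2
  rw [hD]
  simp only [hs _ q l]

theorem cov3_symm12 (hD : ∀ i j f, D i (D j f) = D j (D i f)) (hs : ∀ a l q, Γ a l q = Γ a q l)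
    (φ : A) (l q t : ι) : cov3 D Γ φ l q t = cov3 D Γ φ q l t := by
  unfold cov3
  rw [cov2_symm D Γ hD hs φ l q]
  simp only [cov2_symm D Γ hD hs φ l, cov2_symm D Γ hD hs φ _ q]
  ring

theorem cov3_symm23 (hD : ∀ i j f, D i (D j f) = D j (D i f)) (hs : ∀ a l q, Γ a l q = Γ a q l)
    (flat : ∀ b q l t, D t (Γ b q l) + ∑ a, Γ b t a * Γ a q l
      = D q (Γ b t l) + ∑ a, Γ b q a * Γ a t l)
    (φ : A) (l q t : ι) : cov3 D Γ φ l q t = cov3 D Γ φ l t q := by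
  have e : ∀ q t, cov3 D Γ φ l q t = D t (D q (D l φ)) - ∑ a, (Γ a q l * D t (D a φ)
      + Γ a t l * D q (D a φ)) - ∑ a, Γ a t q * cov2 D Γ φ l a
      - ∑ b, (D t (Γ b q l) - ∑ a, Γ b q a * Γ a t l) * D b φ := by
    intro q t
    have : ∑ a, Γ a t l * cov2 D Γ φ a q = ∑ a, Γ a t l * D q (D a φ)
        - ∑ b, (∑ a, Γ b q a * Γ a t l) * D b φ := by
      simp only [cov2, mul_sub, Finset.sum_sub_distrib, Finset.mul_sum, Finset.sum_mul]
      congr 1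
      rw [Finset.sum_comm]
      refine Finset.sum_congr rfl fun _ _ => Finset.sum_congr rfl fun _ _ => by ring
    rw [cov3, this, cov2]
    simp only [map_sub, map_sum, D_mul, sub_mul, Finset.sum_add_distrib, Finset.sum_sub_distrib]
    ring
  rw [e, e, hD t q]
  have f : ∀ b, D t (Γ b q l) - ∑ a, Γ b q a * Γ a t l
      = D q (Γ b t l) - ∑ a, Γ b t a * Γ a q l := by
    intro b; linear_combination flat b q l t
  simp only [f, hs _ t q, add_comm]

theorem cov2_mul (φ ψ : A) (l q : ι) : cov2 D Γ (φ * ψ) l q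
    = φ * cov2 D Γ ψ l q + D l φ * D q ψ + D q φ * D l ψ + cov2 D Γ φ l q * ψ := by
  simp only [cov2, D_mul, map_add, mul_add, Finset.sum_add_distrib, mul_sub, sub_mul,
    Finset.mul_sum, Finset.sum_mul]
  have e1 : ∑ t, Γ t q l * (D t φ * ψ) = ∑ t, Γ t q l * D t φ * ψ :=
    Finset.sum_congr rfl fun _ _ => by ring
  have e2 : ∑ t, Γ t q l * (φ * D t ψ) = ∑ t, φ * (Γ t q l * D t ψ) :=
    Finset.sum_congr rfl fun _ _ => by ring
  rw [e1, e2]; ring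

theorem cov3_mul (φ ψ : A) (l q t : ι) : cov3 D Γ (φ * ψ) l q t
    = φ * cov3 D Γ ψ l q t + D l φ * cov2 D Γ ψ q t + D q φ * cov2 D Γ ψ l t
      + D t φ * cov2 D Γ ψ l q
      + cov2 D Γ φ q t * D l ψ + cov2 D Γ φ l t * D q ψ + cov2 D Γ φ l q * D t ψ
      + cov3 D Γ φ l q t * ψ := by
  have e1 : ∑ a, Γ a t l * cov2 D Γ (φ * ψ) a q
      = φ * ∑ a, Γ a t l * cov2 D Γ ψ a q + (∑ a, Γ a t l * D a φ) * D q ψ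
        + D q φ * (∑ a, Γ a t l * D a ψ) + (∑ a, Γ a t l * cov2 D Γ φ a q) * ψ := by
    simp only [cov2_mul, Finset.mul_sum, Finset.sum_mul, ← Finset.sum_add_distrib]
    exact Finset.sum_congr rfl fun _ _ => by ring
  have e2 : ∑ a, Γ a t q * cov2 D Γ (φ * ψ) l a
      = φ * ∑ a, Γ a t q * cov2 D Γ ψ l a + (∑ a, Γ a t q * D a φ) * D l ψ
        + D l φ * (∑ a, Γ a t q * D a ψ) + (∑ a, Γ a t q * cov2 D Γ φ l a) * ψ := by
    simp only [cov2_mul, Finset.mul_sum, Finset.sum_mul, ← Finset.sum_add_distrib]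
    exact Finset.sum_congr rfl fun _ _ => by ring
  have d : ∀ (f : A) (i j : ι), ∑ a, Γ a j i * D a f = D j (D i f) - cov2 D Γ f i j := by
    intro f i j; simp [cov2]
  rw [cov3, e1, e2, cov2_mul]
  simp only [d, map_add, D_mul]
  simp only [cov3]
  ring

/-- Second covariant derivative of a contraction. -/
theorem cov2_contr (hΓ : ∀ q l k, D q (h l k) = - ∑ a, Γ l q a * h a k) (φ : A) (Y : ι → A)
    (l q : ι) :
    cov2 D Γ (∑ t, ∑ s, h t s * (D t φ * Y s)) l q
      = ∑ t, ∑ s, h t s * (cov3 D Γ φ t l q * Y s + cov2 D Γ φ t l * D q (Y s)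
          + cov2 D Γ φ t q * D l (Y s) + D t φ * cov2 D Γ (Y s) l q) := by
  have d1 : ∀ l, D l (∑ t, ∑ s, h t s * (D t φ * Y s))
      = ∑ t, ∑ s, h t s * (cov2 D Γ φ t l * Y s + D t φ * D l (Y s)) := by
    intro l
    rw [D_contr D h Γ hΓ]
    refine Finset.sum_congr rfl fun t _ => Finset.sum_congr rfl fun s _ => ?_
    congr 1
    simp only [cov2, D_mul, sub_mul, Finset.sum_mul, mul_assoc]
    ring
  rw [cov2, d1 l, D_contr D h Γ hΓ]
  simp only [d1]
  have : ∑ a, Γ a q l * ∑ t, ∑ s, h t s * (cov2 D Γ φ t a * Y s + D t φ * D a (Y s))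
      = ∑ t, ∑ s, h t s * ∑ a, Γ a q l * (cov2 D Γ φ t a * Y s + D t φ * D a (Y s)) := by
    simp only [Finset.mul_sum]
    rw [Finset.sum_comm]
    refine Finset.sum_congr rfl fun t _ => ?_
    rw [Finset.sum_comm]
    exact Finset.sum_congr rfl fun _ _ => Finset.sum_congr rfl fun _ _ => by ring
  rw [this]
  simp only [← Finset.sum_sub_distrib, ← mul_sub]
  refine Finset.sum_congr rfl fun t _ => Finset.sum_congr rfl fun s _ => ?_
  congr 1
  have d : ∀ (f : A) (i j : ι), ∑ a, Γ a j i * D a f = D j (D i f) - cov2 D Γ f i j := by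
    intro f i j; simp [cov2]
  have e1 : ∑ a, Γ a q t * (cov2 D Γ φ a l * Y s + D a φ * D l (Y s))
      = (∑ a, Γ a q t * cov2 D Γ φ a l) * Y s + (∑ a, Γ a q t * D a φ) * D l (Y s) := by
    simp only [Finset.sum_mul, ← Finset.sum_add_distrib]
    exact Finset.sum_congr rfl fun _ _ => by ring
  have e2 : ∑ a, Γ a q l * (cov2 D Γ φ t a * Y s + D t φ * D a (Y s))
      = (∑ a, Γ a q l * cov2 D Γ φ t a) * Y s + D t φ * (∑ a, Γ a q l * D a (Y s)) := by
    simp only [Finset.sum_mul, Finset.mul_sum, ← Finset.sum_add_distrib]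
    exact Finset.sum_congr rfl fun _ _ => by ring
  rw [e1, e2, d, d, cov3]
  simp only [map_add, D_mul]
  ring

/-- Derivative of a double contraction. -/
theorem D_contr2 (hΓ : ∀ q l k, D q (h l k) = - ∑ a, Γ l q a * h a k) (φ : A) (Y : ι → ι → A)
    (t : ι) :
    D t (∑ l, ∑ k, ∑ q, ∑ p, h l k * (h q p * (cov2 D Γ φ l q * Y k p)))
      = ∑ l, ∑ k, ∑ q, ∑ p, h l k * (h q p * (cov3 D Γ φ l q t * Y k p
          + cov2 D Γ φ l q * D t (Y k p))) := by
  simp only [← Finset.mul_sum]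
  rw [D_contr D h Γ hΓ]
  refine Finset.sum_congr rfl fun l _ => Finset.sum_congr rfl fun k _ => ?_
  congr 1
  rw [D_contr D h Γ hΓ]
  have : ∑ a, Γ a t l * ∑ q, ∑ p, h q p * (cov2 D Γ φ a q * Y k p)
      = ∑ q, ∑ p, h q p * ∑ a, Γ a t l * (cov2 D Γ φ a q * Y k p) := by
    simp only [Finset.mul_sum]
    rw [Finset.sum_comm]
    refine Finset.sum_congr rfl fun t _ => ?_
    rw [Finset.sum_comm]
    exact Finset.sum_congr rfl fun _ _ => Finset.sum_congr rfl fun _ _ => by ring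
  rw [this]
  simp only [← Finset.sum_sub_distrib, ← mul_sub]
  refine Finset.sum_congr rfl fun q _ => Finset.sum_congr rfl fun p _ => ?_
  congr 1
  simp only [cov3, D_mul, sub_mul, Finset.sum_mul, mul_assoc]
  ring

/-- The Christoffel symbols are flat in the purely (anti)holomorphic directions. -/
theorem gamA_flat (g : ι → ι → A) (hD : ∀ i j f, D i (D j f) = D j (D i f))
    (hΓ : ∀ q l k, D q (h l k) = - ∑ a, gamA D h g l q a * h a k) (b q l t : ι) :
    D t (gamA D h g b q l) + ∑ a, gamA D h g b t a * gamA D h g a q l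
      = D q (gamA D h g b t l) + ∑ a, gamA D h g b q a * gamA D h g a t l := by
  have e : ∀ q t, D t (gamA D h g b q l) = ∑ s, h b s * D t (D q (g s l))
      - ∑ a, gamA D h g b t a * gamA D h g a q l := by
    intro q t
    conv_lhs => rw [gamA]
    simp only [map_sum, D_mul, hΓ, Finset.sum_add_distrib, neg_mul, Finset.sum_neg_distrib]
    have : ∑ s, (∑ a, gamA D h g b t a * h a s) * D q (g s l)
        = ∑ a, gamA D h g b t a * gamA D h g a q l := by
      conv_rhs => enter [2, a, 2]; rw [gamA]
      simp only [Finset.sum_mul, Finset.mul_sum]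
      rw [Finset.sum_comm]
      exact Finset.sum_congr rfl fun _ _ => Finset.sum_congr rfl fun _ _ => by ring
    rw [this]; ring
  rw [e, e]
  simp only [hD t q]
  ring

/-- A transversal derivation commutes with the second covariant derivative up to curvature. -/
theorem E_cov2 (E : Derivation ℂ A A) (hE : ∀ i f, E (D i f) = D i (E f)) (ψ : A) (l q : ι) :
    E (cov2 D Γ ψ l q) = cov2 D Γ (E ψ) l q - ∑ a, E (Γ a q l) * D a ψ := by
  simp only [cov2, map_sub, map_sum, D_mul, hE, Finset.sum_add_distrib]
  ring

/-- Curvature in terms of the Christoffel symbols. -/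
theorem curv_gam (g : ι → ι → A) (E : Derivation ℂ A A)
    (hg : ∀ l q, ∑ k, h l k * g k q = if l = q then 1 else 0)
    (hΓ : ∀ q l k, D q (h l k) = - ∑ a, Γ l q a * h a k)
    (q p l : ι) :
    E (D l (h q p)) - ∑ m, ∑ m', D l (h q m) * E (h m' p) * g m m'
      = - ∑ c, E (Γ q l c) * h c p := by
  have : ∑ m, ∑ m', D l (h q m) * E (h m' p) * g m m' = - ∑ a, Γ q l a * E (h a p) := by
    rw [Finset.sum_comm]
    have : ∀ m', ∑ m, D l (h q m) * g m m' = - Γ q l m' := by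
      intro m'
      simp only [hΓ, neg_mul, Finset.sum_neg_distrib, Finset.sum_mul]
      rw [Finset.sum_comm]
      simp only [mul_assoc, ← Finset.mul_sum, hg]
      simp
    calc _ = ∑ m', (∑ m, D l (h q m) * g m m') * E (h m' p) := by
          simp only [Finset.sum_mul]
          exact Finset.sum_congr rfl fun _ _ => Finset.sum_congr rfl fun _ _ => by ring
      _ = _ := by simp only [this, neg_mul, Finset.sum_neg_distrib]
  rw [this, hΓ]
  simp only [map_neg, map_sum, D_mul, Finset.sum_add_distrib]
  ring

end Half
section Main

set_option linter.unusedSectionVars false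

variable {ι : Type} [Fintype ι] [DecidableEq ι] {A : Type} [CommRing A] [Algebra ℂ A]

/-- Triple contraction with the inverse metric. -/
def T3 (h : ι → ι → A) (Z : ι → ι → ι → ι → ι → ι → A) : A :=
  ∑ l, ∑ k, ∑ q, ∑ p, ∑ t, ∑ s, h l k * (h q p * (h t s * Z l k q p t s))

/-- Double contraction with the inverse metric. -/
def T2 (h : ι → ι → A) (Z : ι → ι → ι → ι → A) : A :=
  ∑ l, ∑ k, ∑ q, ∑ p, h l k * (h q p * Z l k q p)

theorem T3_congr (h : ι → ι → A) {Z Z' : ι → ι → ι → ι → ι → ι → A}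
    (H : ∀ l k q p t s, Z l k q p t s = Z' l k q p t s) : T3 h Z = T3 h Z' := by
  have : Z = Z' := by funext l k q p t s; exact H l k q p t s
  rw [this]

theorem T3_add (h : ι → ι → A) (Z Z' : ι → ι → ι → ι → ι → ι → A) :
    T3 h (fun l k q p t s => Z l k q p t s + Z' l k q p t s) = T3 h Z + T3 h Z' := by
  simp only [T3, mul_add, Finset.sum_add_distrib]

theorem T3_sub (h : ι → ι → A) (Z Z' : ι → ι → ι → ι → ι → ι → A) :
    T3 h (fun l k q p t s => Z l k q p t s - Z' l k q p t s) = T3 h Z - T3 h Z' := by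
  simp only [T3, mul_sub, Finset.sum_sub_distrib]

theorem T3_mul (h : ι → ι → A) (c : A) (Z : ι → ι → ι → ι → ι → ι → A) :
    T3 h (fun l k q p t s => c * Z l k q p t s) = c * T3 h Z := by
  simp only [T3, Finset.mul_sum]
  iterate 6 refine Finset.sum_congr rfl fun _ _ => ?_
  ring

theorem T3_prod (h : ι → ι → A) (Z : ι → ι → ι → ι → ι → ι → A) :
    T3 h Z = ∑ x : ι × ι, ∑ y : ι × ι, ∑ w : ι × ι,
      h x.1 x.2 * (h y.1 y.2 * (h w.1 w.2 * Z x.1 x.2 y.1 y.2 w.1 w.2)) := by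
  simp only [T3, Fintype.sum_prod_type]

theorem T3_swap12 (h : ι → ι → A) (Z : ι → ι → ι → ι → ι → ι → A) :
    T3 h Z = T3 h (fun l k q p t s => Z q p l k t s) := by
  rw [T3_prod, T3_prod, Finset.sum_comm]
  iterate 3 refine Finset.sum_congr rfl fun _ _ => ?_
  ring

theorem T3_swap23 (h : ι → ι → A) (Z : ι → ι → ι → ι → ι → ι → A) :
    T3 h Z = T3 h (fun l k q p t s => Z l k t s q p) := by
  rw [T3_prod, T3_prod]
  refine Finset.sum_congr rfl fun _ _ => ?_
  rw [Finset.sum_comm]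
  iterate 2 refine Finset.sum_congr rfl fun _ _ => ?_
  ring

theorem T3_swap13 (h : ι → ι → A) (Z : ι → ι → ι → ι → ι → ι → A) :
    T3 h Z = T3 h (fun l k q p t s => Z t s q p l k) := by
  rw [T3_swap12, T3_swap23, T3_swap12]

theorem T3_flip (h : ι → ι → A) (Z : ι → ι → ι → ι → ι → ι → A) :
    T3 (fun k l => h l k) Z = T3 h (fun l k q p t s => Z k l p q s t) := by
  rw [T3_prod, T3_prod]
  refine Fintype.sum_equiv (Equiv.prodComm ι ι) _ _ fun _ => ?_
  refine Fintype.sum_equiv (Equiv.prodComm ι ι) _ _ fun _ => ?_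
  refine Fintype.sum_equiv (Equiv.prodComm ι ι) _ _ fun _ => ?_
  rfl

theorem T2_flip (h : ι → ι → A) (Z : ι → ι → ι → ι → A) :
    T2 (fun k l => h l k) Z = T2 h (fun l k q p => Z k l p q) := by
  have : ∀ (h : ι → ι → A) (Z : ι → ι → ι → ι → A), T2 h Z = ∑ x : ι × ι, ∑ y : ι × ι,
      h x.1 x.2 * (h y.1 y.2 * (Z x.1 x.2 y.1 y.2)) := by
    intro h Z; simp only [T2, Fintype.sum_prod_type]
  rw [this, this]
  refine Fintype.sum_equiv (Equiv.prodComm ι ι) _ _ fun _ => ?_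
  refine Fintype.sum_equiv (Equiv.prodComm ι ι) _ _ fun _ => ?_
  rfl

section halves

variable (D : ι → Derivation ℂ A A) (h : ι → ι → A) (Γ : ι → ι → ι → A)

theorem half_c21 (hΓ : ∀ q l k, D q (h l k) = - ∑ a, Γ l q a * h a k) (φ : A) (Y : ι → A)
    (X : ι → ι → A) :
    T2 h (fun l k q p => cov2 D Γ (∑ t, ∑ s, h t s * (D t φ * Y s)) l q * X k p)
      = T3 h (fun l k q p t s => (cov3 D Γ φ t l q * Y s + cov2 D Γ φ t l * D q (Y s)
          + cov2 D Γ φ t q * D l (Y s) + D t φ * cov2 D Γ (Y s) l q) * X k p) := by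
  simp only [T2, T3, cov2_contr D h Γ hΓ, Finset.sum_mul, Finset.mul_sum, mul_assoc]

theorem half_c12 (hΓ : ∀ q l k, D q (h l k) = - ∑ a, Γ l q a * h a k) (φ : A) (Y : ι → ι → A)
    (X : ι → A) :
    ∑ t, ∑ s, h t s * (D t (T2 h fun l k q p => cov2 D Γ φ l q * Y k p) * X s)
      = T3 h (fun t s l k q p => (cov3 D Γ φ l q t * Y k p + cov2 D Γ φ l q * D t (Y k p))
          * X s) := by
  simp only [T2, T3, D_contr2 D h Γ hΓ, Finset.sum_mul, Finset.mul_sum, mul_assoc]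

/-- The curvature term. -/
theorem half_K (W : ι → ι → ι → ι → A) (hW : ∀ s a b c, W s a b c = W s a c b)
    (R : ι → ι → ι → ι → A) (hR : ∀ a p s b, R a p s b = - ∑ c, W s a b c * h c p)
    (Y V : ι → A) (X : ι → ι → A) :
    T3 h (fun l k q p t s => Y t * (∑ a, W s a q l * V a) * X k p)
      = - ∑ t, ∑ k, ∑ a, ∑ p, (∑ s, ∑ b, h t s * h b k * R a p s b) * (Y t * V a * X k p) := by
  simp only [T3, hR, mul_neg, neg_mul, Finset.sum_neg_distrib, neg_neg, Finset.mul_sum,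
    Finset.sum_mul]
  simp only [← Fintype.sum_prod_type']
  refine Fintype.sum_equiv
    { toFun := fun x : ι × ι × ι × ι × ι × ι × ι =>
        (x.2.2.2.2.1, x.2.1, x.2.2.2.2.2.2, x.2.2.2.1, x.2.2.2.2.2.1, x.1, x.2.2.1)
      invFun := fun y : ι × ι × ι × ι × ι × ι × ι =>
        (y.2.2.2.2.2.1, y.2.1, y.2.2.2.2.2.2, y.2.2.2.1, y.1, y.2.2.2.2.1, y.2.2.1)
      left_inv := fun _ => rfl
      right_inv := fun _ => rfl } _ _ fun x => ?_
  simp only [Equiv.coe_fn_mk]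
  rw [hW]
  ring

end halves

/-- `C₁` in an abstract differential algebra. -/
def C1A (P B : ι → Derivation ℂ A A) (h : ι → ι → A) (φ ψ : A) : A :=
  ∑ l, ∑ k, h l k * (B l φ * P k ψ)

/-- Twice `C₂`. -/
def C2A (P B : ι → Derivation ℂ A A) (h : ι → ι → A) (ΓB ΓH : ι → ι → ι → A) (φ ψ : A) : A :=
  T2 h fun l k q p => cov2 B ΓB φ l q * cov2 P ΓH ψ k p

/-- Leading part of `C₃` (times six). -/
def M3A (P B : ι → Derivation ℂ A A) (h : ι → ι → A) (ΓB ΓH : ι → ι → ι → A) (φ ψ : A) : A :=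
  T3 h fun l k q p t s => cov3 B ΓB φ l q t * cov3 P ΓH ψ k p s

/-- Curvature part of `C₃` (times four). -/
def KA (P B : ι → Derivation ℂ A A) (h : ι → ι → A) (ΓB ΓH : ι → ι → ι → A)
    (R : ι → ι → ι → ι → A) (φ ψ : A) : A :=
  ∑ l, ∑ k, ∑ q, ∑ p, (∑ a, ∑ b, h l a * h b k * R q p a b) *
    (cov2 B ΓB φ l q * cov2 P ΓH ψ k p)

/-- Last part of `C₃` (times twelve). -/
def SA (P B : ι → Derivation ℂ A A) (S : ι → ι → A) (φ ψ : A) : A :=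
  ∑ l, ∑ k, S l k * (B l φ * P k ψ)

theorem SA_cocycle (P B : ι → Derivation ℂ A A) (S : ι → ι → A) (φ ψ χ : A) :
    SA P B S φ ψ * χ + SA P B S (φ * ψ) χ = φ * SA P B S ψ χ + SA P B S φ (ψ * χ) := by
  simp only [SA, Finset.sum_mul, Finset.mul_sum, ← Finset.sum_add_distrib, D_mul]
  exact Finset.sum_congr rfl fun _ _ => Finset.sum_congr rfl fun _ _ => by ring

section final

variable (P B : ι → Derivation ℂ A A) (h : ι → ι → A) (ΓB ΓH : ι → ι → ι → A)
  (R : ι → ι → ι → ι → A)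

theorem M3_coboundary
    (symB12 : ∀ φ l q t, cov3 B ΓB φ l q t = cov3 B ΓB φ q l t)
    (symB23 : ∀ φ l q t, cov3 B ΓB φ l q t = cov3 B ΓB φ l t q)
    (symH12 : ∀ φ l q t, cov3 P ΓH φ l q t = cov3 P ΓH φ q l t)
    (symH23 : ∀ φ l q t, cov3 P ΓH φ l q t = cov3 P ΓH φ l t q)
    (φ ψ χ : A) :
    M3A P B h ΓB ΓH φ ψ * χ + M3A P B h ΓB ΓH (φ * ψ) χ
      - φ * M3A P B h ΓB ΓH ψ χ - M3A P B h ΓB ΓH φ (ψ * χ)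
      = 3 * (T3 h (fun l k q p t s => B l φ * cov2 B ΓB ψ q t * cov3 P ΓH χ k p s)
        + T3 h (fun l k q p t s => cov2 B ΓB φ q t * B l ψ * cov3 P ΓH χ k p s)
        - T3 h (fun l k q p t s => cov3 B ΓB φ l q t * (P k ψ * cov2 P ΓH χ p s))
        - T3 h (fun l k q p t s => cov3 B ΓB φ l q t * (cov2 P ΓH ψ p s * P k χ))) := by
  have a1 : T3 h (fun l k q p t s => B q φ * cov2 B ΓB ψ l t * cov3 P ΓH χ k p s)
      = T3 h (fun l k q p t s => B l φ * cov2 B ΓB ψ q t * cov3 P ΓH χ k p s) := by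
    rw [T3_swap12]
    exact T3_congr h fun l k q p t s => by rw [symH12 χ p k s]
  have a2 : T3 h (fun l k q p t s => B t φ * cov2 B ΓB ψ l q * cov3 P ΓH χ k p s)
      = T3 h (fun l k q p t s => B q φ * cov2 B ΓB ψ l t * cov3 P ΓH χ k p s) := by
    rw [T3_swap23]
    exact T3_congr h fun l k q p t s => by rw [symH23 χ k s p]
  have b1 : T3 h (fun l k q p t s => cov2 B ΓB φ l t * B q ψ * cov3 P ΓH χ k p s)
      = T3 h (fun l k q p t s => cov2 B ΓB φ q t * B l ψ * cov3 P ΓH χ k p s) := by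
    rw [T3_swap12]
    exact T3_congr h fun l k q p t s => by rw [symH12 χ p k s]
  have b2 : T3 h (fun l k q p t s => cov2 B ΓB φ l q * B t ψ * cov3 P ΓH χ k p s)
      = T3 h (fun l k q p t s => cov2 B ΓB φ l t * B q ψ * cov3 P ΓH χ k p s) := by
    rw [T3_swap23]
    exact T3_congr h fun l k q p t s => by rw [symH23 χ k s p]
  have c1 : T3 h (fun l k q p t s => cov3 B ΓB φ l q t * (P p ψ * cov2 P ΓH χ k s))
      = T3 h (fun l k q p t s => cov3 B ΓB φ l q t * (P k ψ * cov2 P ΓH χ p s)) := by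
    rw [T3_swap12]
    exact T3_congr h fun l k q p t s => by rw [symB12 φ q l t]
  have c2 : T3 h (fun l k q p t s => cov3 B ΓB φ l q t * (P s ψ * cov2 P ΓH χ k p))
      = T3 h (fun l k q p t s => cov3 B ΓB φ l q t * (P p ψ * cov2 P ΓH χ k s)) := by
    rw [T3_swap23]
    exact T3_congr h fun l k q p t s => by rw [symB23 φ l t q]
  have d1 : T3 h (fun l k q p t s => cov3 B ΓB φ l q t * (cov2 P ΓH ψ k s * P p χ))
      = T3 h (fun l k q p t s => cov3 B ΓB φ l q t * (cov2 P ΓH ψ p s * P k χ)) := by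
    rw [T3_swap12]
    exact T3_congr h fun l k q p t s => by rw [symB12 φ q l t]
  have d2 : T3 h (fun l k q p t s => cov3 B ΓB φ l q t * (cov2 P ΓH ψ k p * P s χ))
      = T3 h (fun l k q p t s => cov3 B ΓB φ l q t * (cov2 P ΓH ψ k s * P p χ)) := by
    rw [T3_swap23]
    exact T3_congr h fun l k q p t s => by rw [symB23 φ l t q]
  have e1 : M3A P B h ΓB ΓH (φ * ψ) χ = φ * M3A P B h ΓB ΓH ψ χ
      + T3 h (fun l k q p t s => B l φ * cov2 B ΓB ψ q t * cov3 P ΓH χ k p s)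
      + T3 h (fun l k q p t s => B q φ * cov2 B ΓB ψ l t * cov3 P ΓH χ k p s)
      + T3 h (fun l k q p t s => B t φ * cov2 B ΓB ψ l q * cov3 P ΓH χ k p s)
      + T3 h (fun l k q p t s => cov2 B ΓB φ q t * B l ψ * cov3 P ΓH χ k p s)
      + T3 h (fun l k q p t s => cov2 B ΓB φ l t * B q ψ * cov3 P ΓH χ k p s)
      + T3 h (fun l k q p t s => cov2 B ΓB φ l q * B t ψ * cov3 P ΓH χ k p s)
      + ψ * M3A P B h ΓB ΓH φ χ := by
    simp only [M3A, ← T3_mul, ← T3_add]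
    exact T3_congr h fun l k q p t s => by rw [cov3_mul]; ring
  have e2 : M3A P B h ΓB ΓH φ (ψ * χ) = ψ * M3A P B h ΓB ΓH φ χ
      + T3 h (fun l k q p t s => cov3 B ΓB φ l q t * (P k ψ * cov2 P ΓH χ p s))
      + T3 h (fun l k q p t s => cov3 B ΓB φ l q t * (P p ψ * cov2 P ΓH χ k s))
      + T3 h (fun l k q p t s => cov3 B ΓB φ l q t * (P s ψ * cov2 P ΓH χ k p))
      + T3 h (fun l k q p t s => cov3 B ΓB φ l q t * (cov2 P ΓH ψ p s * P k χ))
      + T3 h (fun l k q p t s => cov3 B ΓB φ l q t * (cov2 P ΓH ψ k s * P p χ))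
      + T3 h (fun l k q p t s => cov3 B ΓB φ l q t * (cov2 P ΓH ψ k p * P s χ))
      + χ * M3A P B h ΓB ΓH φ ψ := by
    simp only [M3A, ← T3_mul, ← T3_add]
    exact T3_congr h fun l k q p t s => by rw [cov3_mul]; ring
  rw [e1, e2, a2, a1, b2, b1, c2, c1, d2, d1]
  ring

/-- `Σ R^{l̄kq̄p} φ_l ψ_q χ_{kp}` -/
def K1A (φ ψ χ : A) : A :=
  ∑ l, ∑ k, ∑ q, ∑ p, (∑ a, ∑ b, h l a * h b k * R q p a b) * (B l φ * B q ψ * cov2 P ΓH χ k p)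

/-- `Σ R^{l̄kq̄p} φ_{lq} ψ_p χ_k` -/
def K2A (φ ψ χ : A) : A :=
  ∑ l, ∑ k, ∑ q, ∑ p, (∑ a, ∑ b, h l a * h b k * R q p a b) * (P k χ * P p ψ * cov2 B ΓB φ l q)

theorem KA_coboundary
    (symlq : ∀ l k q p, ∑ a, ∑ b, h l a * h b k * R q p a b = ∑ a, ∑ b, h q a * h b k * R l p a b)
    (symkp : ∀ l k q p, ∑ a, ∑ b, h l a * h b k * R q p a b = ∑ a, ∑ b, h l a * h b p * R q k a b)
    (φ ψ χ : A) :
    KA P B h ΓB ΓH R φ ψ * χ + KA P B h ΓB ΓH R (φ * ψ) χ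
      - φ * KA P B h ΓB ΓH R ψ χ - KA P B h ΓB ΓH R φ (ψ * χ)
      = 2 * (K1A P B h ΓH R φ ψ χ - K2A P B h ΓB R φ ψ χ) := by
  have k1 : K1A P B h ΓH R φ ψ χ = ∑ l, ∑ k, ∑ q, ∑ p,
      (∑ a, ∑ b, h l a * h b k * R q p a b) * (B q φ * B l ψ * cov2 P ΓH χ k p) := by
    rw [K1A]
    calc _ = ∑ l, ∑ q, ∑ k, ∑ p, (∑ a, ∑ b, h l a * h b k * R q p a b) *
            (B l φ * B q ψ * cov2 P ΓH χ k p) := Finset.sum_congr rfl fun _ _ => Finset.sum_comm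
      _ = ∑ q, ∑ l, ∑ k, ∑ p, (∑ a, ∑ b, h l a * h b k * R q p a b) *
            (B l φ * B q ψ * cov2 P ΓH χ k p) := Finset.sum_comm
      _ = ∑ q, ∑ k, ∑ l, ∑ p, (∑ a, ∑ b, h l a * h b k * R q p a b) *
            (B l φ * B q ψ * cov2 P ΓH χ k p) := Finset.sum_congr rfl fun _ _ => Finset.sum_comm
      _ = _ := by
        iterate 4 refine Finset.sum_congr rfl fun _ _ => ?_
        rw [symlq]
  have k2 : K2A P B h ΓB R φ ψ χ = ∑ l, ∑ k, ∑ q, ∑ p,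
      (∑ a, ∑ b, h l a * h b k * R q p a b) * (P p χ * P k ψ * cov2 B ΓB φ l q) := by
    rw [K2A]
    refine Finset.sum_congr rfl fun l _ => ?_
    calc _ = ∑ q, ∑ k, ∑ p, (∑ a, ∑ b, h l a * h b k * R q p a b) *
            (P k χ * P p ψ * cov2 B ΓB φ l q) := Finset.sum_comm
      _ = ∑ q, ∑ p, ∑ k, (∑ a, ∑ b, h l a * h b k * R q p a b) *
            (P k χ * P p ψ * cov2 B ΓB φ l q) := Finset.sum_congr rfl fun _ _ => Finset.sum_comm
      _ = ∑ p, ∑ q, ∑ k, (∑ a, ∑ b, h l a * h b k * R q p a b) *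
            (P k χ * P p ψ * cov2 B ΓB φ l q) := Finset.sum_comm
      _ = _ := by
        iterate 3 refine Finset.sum_congr rfl fun _ _ => ?_
        rw [symkp]
  have : 2 * (K1A P B h ΓH R φ ψ χ - K2A P B h ΓB R φ ψ χ)
      = (K1A P B h ΓH R φ ψ χ + K1A P B h ΓH R φ ψ χ)
        - (K2A P B h ΓB R φ ψ χ + K2A P B h ΓB R φ ψ χ) := by ring
  rw [this]
  nth_rewrite 2 [k1]
  nth_rewrite 2 [k2]
  simp only [KA, K1A, K2A]
  simp only [Finset.sum_mul _ _ χ, Finset.mul_sum _ _ φ, ← Finset.sum_add_distrib,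
    ← Finset.sum_sub_distrib]
  iterate 4 refine Finset.sum_congr rfl fun _ _ => ?_
  rw [cov2_mul, cov2_mul]
  ring


theorem R_symkp (sB : ∀ a l q, ΓB a l q = ΓB a q l)
    (RB : ∀ q p k l, R q p k l = - ∑ c, P k (ΓB q l c) * h c p) (l k q p : ι) :
    ∑ a, ∑ b, h l a * h b k * R q p a b = ∑ a, ∑ b, h l a * h b p * R q k a b := by
  simp only [RB, mul_neg, Finset.sum_neg_distrib, Finset.mul_sum]
  congr 1
  refine Finset.sum_congr rfl fun _ _ => ?_
  rw [Finset.sum_comm]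
  iterate 2 refine Finset.sum_congr rfl fun _ _ => ?_
  rw [sB]; ring

theorem R_symlq (sH : ∀ a l q, ΓH a l q = ΓH a q l)
    (RH : ∀ q p k l, R q p k l = - ∑ c, B l (ΓH p k c) * h q c) (l k q p : ι) :
    ∑ a, ∑ b, h l a * h b k * R q p a b = ∑ a, ∑ b, h q a * h b k * R l p a b := by
  simp only [RH, mul_neg, Finset.sum_neg_distrib, Finset.mul_sum]
  congr 1
  rw [Finset.sum_comm]
  rw [Finset.sum_comm (f := fun a b => ∑ c, h q a * h b k * (B b (ΓH p a c) * h l c))]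
  refine Finset.sum_congr rfl fun _ _ => ?_
  rw [Finset.sum_comm]
  iterate 2 refine Finset.sum_congr rfl fun _ _ => ?_
  rw [sH]; ring

theorem D_const_mul (D : Derivation ℂ A A) (c : ℂ) (x : A) :
    D (algebraMap ℂ A c * x) = algebraMap ℂ A c * D x := by
  rw [D_mul, Derivation.map_algebraMap]; ring

theorem cov2_const_mul (D : ι → Derivation ℂ A A) (Γ : ι → ι → ι → A) (c : ℂ) (x : A) (l q : ι) :
    cov2 D Γ (algebraMap ℂ A c * x) l q = algebraMap ℂ A c * cov2 D Γ x l q := by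
  simp only [cov2, D_const_mul, mul_sub, Finset.mul_sum]
  congr 1
  exact Finset.sum_congr rfl fun _ _ => by ring

/-- `C₃` in an abstract differential algebra. -/
def C3A (S : ι → ι → A) (φ ψ : A) : A :=
  algebraMap ℂ A (1 / 6) * M3A P B h ΓB ΓH φ ψ + algebraMap ℂ A (1 / 4) * KA P B h ΓB ΓH R φ ψ
    + algebraMap ℂ A (1 / 12) * SA P B S φ ψ

theorem K1_eq (sB : ∀ a l q, ΓB a l q = ΓB a q l)
    (RB : ∀ q p k l, R q p k l = - ∑ c, P k (ΓB q l c) * h c p) (φ ψ χ : A) :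
    T3 h (fun l k q p t s => B t φ * (∑ a, P s (ΓB a q l) * B a ψ) * cov2 P ΓH χ k p)
      = - K1A P B h ΓH R φ ψ χ :=
  half_K h (fun s a b c => P s (ΓB a b c)) (fun s a b c => by rw [sB]) R
    (fun a p s b => RB a p s b) (fun t => B t φ) (fun a => B a ψ) (cov2 P ΓH χ)

theorem K2_eq (sH : ∀ a l q, ΓH a l q = ΓH a q l)
    (RH : ∀ q p k l, R q p k l = - ∑ c, B l (ΓH p k c) * h q c) (φ ψ χ : A) :
    T3 h (fun l k q p t s => P s χ * (∑ a, B t (ΓH a p k) * P a ψ) * cov2 B ΓB φ l q)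
      = - K2A P B h ΓB R φ ψ χ := by
  have := half_K (fun k l => h l k) (fun s a b c => B s (ΓH a b c)) (fun s a b c => by rw [sH])
    (fun a p s b => R p a b s)
    (fun a p s b => RH p a b s) (fun t => P t χ) (fun a => P a ψ) (cov2 B ΓB φ)
  rw [T3_flip] at this
  rw [this, K2A]
  congr 1
  rw [Finset.sum_comm]
  refine Finset.sum_congr rfl fun l _ => Finset.sum_congr rfl fun k _ => ?_
  rw [Finset.sum_comm]
  refine Finset.sum_congr rfl fun q _ => Finset.sum_congr rfl fun p _ => ?_
  congr 1
  rw [Finset.sum_comm]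
  exact Finset.sum_congr rfl fun _ _ => Finset.sum_congr rfl fun _ _ => by ring

/-- Abstract version of the third-order associativity identity. -/
theorem assoc3 (S : ι → ι → A)
    (hPP : ∀ i j f, P i (P j f) = P j (P i f)) (hBB : ∀ i j f, B i (B j f) = B j (B i f))
    (hPB : ∀ i j f, P i (B j f) = B j (P i f))
    (sB : ∀ a l q, ΓB a l q = ΓB a q l) (sH : ∀ a l q, ΓH a l q = ΓH a q l)
    (flatB : ∀ b q l t, B t (ΓB b q l) + ∑ a, ΓB b t a * ΓB a q l
      = B q (ΓB b t l) + ∑ a, ΓB b q a * ΓB a t l)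
    (flatH : ∀ b q l t, P t (ΓH b q l) + ∑ a, ΓH b t a * ΓH a q l
      = P q (ΓH b t l) + ∑ a, ΓH b q a * ΓH a t l)
    (hΓB : ∀ q l k, B q (h l k) = - ∑ a, ΓB l q a * h a k)
    (hΓH : ∀ q l k, P q (h k l) = - ∑ a, ΓH l q a * h k a)
    (RB : ∀ q p k l, R q p k l = - ∑ c, P k (ΓB q l c) * h c p)
    (RH : ∀ q p k l, R q p k l = - ∑ c, B l (ΓH p k c) * h q c) (φ ψ χ : A) :
    C3A P B h ΓB ΓH R S φ ψ * χ
      + algebraMap ℂ A (1 / 2) * C2A P B h ΓB ΓH (C1A P B h φ ψ) χ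
      + C1A P B h (algebraMap ℂ A (1 / 2) * C2A P B h ΓB ΓH φ ψ) χ
      + C3A P B h ΓB ΓH R S (φ * ψ) χ
    = φ * C3A P B h ΓB ΓH R S ψ χ
      + algebraMap ℂ A (1 / 2) * C2A P B h ΓB ΓH φ (C1A P B h ψ χ)
      + C1A P B h φ (algebraMap ℂ A (1 / 2) * C2A P B h ΓB ΓH ψ χ)
      + C3A P B h ΓB ΓH R S φ (ψ * χ) := by
  have symB2 := cov2_symm B ΓB hBB sB
  have symH2 := cov2_symm P ΓH hPP sH
  have symB12 := cov3_symm12 B ΓB hBB sB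
  have symH12 := cov3_symm12 P ΓH hPP sH
  have symB23 := cov3_symm23 B ΓB hBB sB flatB
  have symH23 := cov3_symm23 P ΓH hPP sH flatH
  have hM := M3_coboundary P B h ΓB ΓH symB12 symB23 symH12 symH23 φ ψ χ
  have hK := KA_coboundary P B h ΓB ΓH R (R_symlq B h ΓH R sH RH) (R_symkp P h ΓB R sB RB) φ ψ χ
  have hS := SA_cocycle P B S φ ψ χ
  -- the four mixed terms
  have q1 : C2A P B h ΓB ΓH (C1A P B h φ ψ) χ
      = T3 h (fun l k q p t s => cov3 B ΓB φ l q t * (P k ψ * cov2 P ΓH χ p s))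
        + (T3 h (fun l k q p t s => cov2 B ΓB φ t l * B q (P s ψ) * cov2 P ΓH χ k p)
          + T3 h (fun l k q p t s => cov2 B ΓB φ t q * B l (P s ψ) * cov2 P ΓH χ k p))
        + T3 h (fun l k q p t s => B t φ * cov2 B ΓB (P s ψ) l q * cov2 P ΓH χ k p) := by
    have := half_c21 B h ΓB hΓB φ (fun s => P s ψ) (cov2 P ΓH χ)
    have e : T3 h (fun l k q p t s => cov3 B ΓB φ l q t * (P k ψ * cov2 P ΓH χ p s))
        = T3 h (fun l k q p t s => cov3 B ΓB φ t l q * (P s ψ * cov2 P ΓH χ k p)) := by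
      rw [T3_swap13, T3_swap12]
    rw [e]
    simp only [← T3_add]
    refine this.trans (T3_congr h fun l k q p t s => by ring)
  have q2 : C1A P B h (C2A P B h ΓB ΓH φ ψ) χ
      = T3 h (fun l k q p t s => cov3 B ΓB φ l q t * (cov2 P ΓH ψ p s * P k χ))
        + T3 h (fun l k q p t s => P s χ * B t (cov2 P ΓH ψ k p) * cov2 B ΓB φ l q) := by
    have := half_c12 B h ΓB hΓB φ (cov2 P ΓH ψ) (fun s => P s χ)
    have e : T3 h (fun l k q p t s => P s χ * B t (cov2 P ΓH ψ k p) * cov2 B ΓB φ l q)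
        = T3 h (fun l k q p t s => P k χ * B l (cov2 P ΓH ψ s p) * cov2 B ΓB φ t q) := by
      rw [T3_swap13]
    rw [e]
    simp only [← T3_add]
    refine this.trans (T3_congr h fun l k q p t s => ?_)
    rw [symB2 φ q t, symH2 ψ p s, symB12 φ l q t, symB23 φ q l t, symB12 φ q t l]
    ring
  have q3 : C2A P B h ΓB ΓH φ (C1A P B h ψ χ)
      = T3 h (fun l k q p t s => cov2 B ΓB φ q t * B l ψ * cov3 P ΓH χ k p s)
        + (T3 h (fun l k q p t s => cov2 B ΓB φ t l * B q (P s ψ) * cov2 P ΓH χ k p)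
          + T3 h (fun l k q p t s => cov2 B ΓB φ t q * B l (P s ψ) * cov2 P ΓH χ k p))
        + T3 h (fun l k q p t s => P s χ * cov2 P ΓH (B t ψ) k p * cov2 B ΓB φ l q) := by
    have := half_c21 P (fun k l => h l k) ΓH hΓH χ (fun t => B t ψ) (cov2 B ΓB φ)
    have e0 : ∑ t, ∑ s, h s t * (P t χ * B s ψ) = C1A P B h ψ χ := by
      rw [C1A, Finset.sum_comm]
      exact Finset.sum_congr rfl fun _ _ => Finset.sum_congr rfl fun _ _ => by ring
    rw [T3_flip, T2_flip, e0] at this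
    have e1 : T3 h (fun l k q p t s => cov2 B ΓB φ q t * B l ψ * cov3 P ΓH χ k p s)
        = T3 h (fun l k q p t s => cov2 B ΓB φ l q * B t ψ * cov3 P ΓH χ s k p) := by
      rw [T3_swap13, T3_swap12]
    have e2 : T3 h (fun l k q p t s => cov2 B ΓB φ t l * B q (P s ψ) * cov2 P ΓH χ k p)
        = T3 h (fun l k q p t s => cov2 B ΓB φ q l * B t (P p ψ) * cov2 P ΓH χ k s) := by
      rw [T3_swap23]
    have e3 : T3 h (fun l k q p t s => cov2 B ΓB φ t q * B l (P s ψ) * cov2 P ΓH χ k p)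
        = T3 h (fun l k q p t s => cov2 B ΓB φ l q * B t (P k ψ) * cov2 P ΓH χ s p) := by
      rw [T3_swap13]
    have e4 : C2A P B h ΓB ΓH φ (C1A P B h ψ χ)
        = T2 h (fun l k q p => cov2 P ΓH (C1A P B h ψ χ) k p * cov2 B ΓB φ l q) := by
      simp only [C2A, mul_comm]
    rw [e1, e2, e3, e4, this]
    simp only [← T3_add]
    refine T3_congr h fun l k q p t s => ?_
    rw [hPB, hPB, symB2 φ q l, symH2 χ k s]
    ring
  have q4 : C1A P B h φ (C2A P B h ΓB ΓH ψ χ)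
      = T3 h (fun l k q p t s => B l φ * cov2 B ΓB ψ q t * cov3 P ΓH χ k p s)
        + T3 h (fun l k q p t s => B t φ * P s (cov2 B ΓB ψ l q) * cov2 P ΓH χ k p) := by
    have := half_c12 P (fun k l => h l k) ΓH hΓH χ (cov2 B ΓB ψ) (fun t => B t φ)
    rw [T3_flip, T2_flip] at this
    have e0 : (T2 h fun l k q p => cov2 P ΓH χ k p * cov2 B ΓB ψ l q)
        = C2A P B h ΓB ΓH ψ χ := by
      simp only [C2A, mul_comm]
    have e1 : C1A P B h φ (C2A P B h ΓB ΓH ψ χ)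
        = ∑ t, ∑ s, h s t * (P t (C2A P B h ΓB ΓH ψ χ) * B s φ) := by
      rw [C1A, Finset.sum_comm]
      exact Finset.sum_congr rfl fun _ _ => Finset.sum_congr rfl fun _ _ => by ring
    rw [e0] at this
    have e2 : T3 h (fun l k q p t s => B t φ * P s (cov2 B ΓB ψ l q) * cov2 P ΓH χ k p)
        = T3 h (fun l k q p t s => B l φ * P k (cov2 B ΓB ψ t q) * cov2 P ΓH χ s p) := by
      rw [T3_swap13]
    rw [e1, this, e2]
    simp only [← T3_add]
    refine T3_congr h fun l k q p t s => ?_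
    rw [symB2 ψ t q, symH2 χ s p, symH23 χ p s k, symH12 χ p k s]
    ring
  have r1 : T3 h (fun l k q p t s => B t φ * P s (cov2 B ΓB ψ l q) * cov2 P ΓH χ k p)
      = T3 h (fun l k q p t s => B t φ * cov2 B ΓB (P s ψ) l q * cov2 P ΓH χ k p)
        + K1A P B h ΓH R φ ψ χ := by
    rw [← sub_neg_eq_add, ← K1_eq P B h ΓB ΓH R sB RB, ← T3_sub]
    exact T3_congr h fun l k q p t s => by
      rw [E_cov2 B ΓB (P s) (fun i f => hPB s i f)]; ring
  have r2 : T3 h (fun l k q p t s => P s χ * B t (cov2 P ΓH ψ k p) * cov2 B ΓB φ l q)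
      = T3 h (fun l k q p t s => P s χ * cov2 P ΓH (B t ψ) k p * cov2 B ΓB φ l q)
        + K2A P B h ΓB R φ ψ χ := by
    rw [← sub_neg_eq_add, ← K2_eq P B h ΓB ΓH R sH RH, ← T3_sub]
    exact T3_congr h fun l k q p t s => by
      rw [E_cov2 P ΓH (B t) (fun i f => (hPB i t f).symm)]; ring
  have c1l : ∀ (c : ℂ) x y, C1A P B h (algebraMap ℂ A c * x) y = algebraMap ℂ A c * C1A P B h x y := by
    intro c x y
    simp only [C1A, D_const_mul, Finset.mul_sum]
    exact Finset.sum_congr rfl fun _ _ => Finset.sum_congr rfl fun _ _ => by ring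
  have c1r : ∀ (c : ℂ) x y, C1A P B h x (algebraMap ℂ A c * y) = algebraMap ℂ A c * C1A P B h x y := by
    intro c x y
    simp only [C1A, D_const_mul, Finset.mul_sum]
    exact Finset.sum_congr rfl fun _ _ => Finset.sum_congr rfl fun _ _ => by ring
  have n6 : algebraMap ℂ A (1 / 6) * 3 = algebraMap ℂ A (1 / 2) := by
    rw [← map_ofNat (algebraMap ℂ A) 3, ← map_mul]; norm_num
  have n4 : algebraMap ℂ A (1 / 4) * 2 = algebraMap ℂ A (1 / 2) := by
    rw [← map_ofNat (algebraMap ℂ A) 2, ← map_mul]; norm_num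
  rw [c1l, c1r, q1, q2, q3, q4, r1, r2]
  simp only [C3A]
  generalize T3 h (fun l k q p t s => B l φ * cov2 B ΓB ψ q t * cov3 P ΓH χ k p s) = τ₁ at *
  generalize T3 h (fun l k q p t s => cov2 B ΓB φ q t * B l ψ * cov3 P ΓH χ k p s) = τ₂ at *
  generalize T3 h (fun l k q p t s => cov3 B ΓB φ l q t * (P k ψ * cov2 P ΓH χ p s)) = σ₁ at *
  generalize T3 h (fun l k q p t s => cov3 B ΓB φ l q t * (cov2 P ΓH ψ p s * P k χ)) = σ₂ at *
  linear_combination algebraMap ℂ A (1 / 6) * hM + algebraMap ℂ A (1 / 4) * hK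
    + algebraMap ℂ A (1 / 12) * hS + (τ₁ + τ₂ - σ₁ - σ₂) * n6
    + (K1A P B h ΓH R φ ψ χ - K2A P B h ΓB R φ ψ χ) * n4

end final

end Main
section Analysis

/-- Both Wirtinger operators at once. -/
def wdG (n : ℕ) (c : ℂ) (k : Fin n) (f : (Fin n → ℂ) → ℂ) : (Fin n → ℂ) → ℂ :=
  fun z => (1 / 2 : ℂ) *
    (fderiv ℝ f z (ebasis n k) + c * fderiv ℝ f z (Complex.I • ebasis n k))

theorem wdB_eq (n : ℕ) (k : Fin n) : wdB n k = wdG n Complex.I k := rfl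

theorem wdP_eq (n : ℕ) (k : Fin n) : wdP n k = wdG n (-Complex.I) k := by
  funext f z
  simp only [wdP, wdG]
  ring

open Classical in
/-- Extension by zero. -/
def extU {n : ℕ} (U : Set (Fin n → ℂ)) (f : U → ℂ) : (Fin n → ℂ) → ℂ :=
  fun z => if hz : z ∈ U then f ⟨z, hz⟩ else 0

theorem extU_apply {n : ℕ} {U : Set (Fin n → ℂ)} (f : U → ℂ) {z : Fin n → ℂ} (hz : z ∈ U) :
    extU U f z = f ⟨z, hz⟩ := by simp [extU, hz]

/-- The algebra of smooth functions on `U`. -/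
def SmA {n : ℕ} (U : Set (Fin n → ℂ)) : Subalgebra ℂ (U → ℂ) where
  carrier := {f | ContDiffOn ℝ (⊤ : ℕ∞) (extU U f) U}
  mul_mem' := by
    intro a b ha hb
    refine (ContDiffOn.mul ha hb).congr fun z hz => ?_
    simp [extU_apply _ hz]
  add_mem' := by
    intro a b ha hb
    refine (ContDiffOn.add ha hb).congr fun z hz => ?_
    simp [extU_apply _ hz]
  algebraMap_mem' := by
    intro r
    refine (contDiffOn_const (c := r)).congr fun z hz => ?_
    simp [extU_apply _ hz]

variable {n : ℕ} {U : Set (Fin n → ℂ)}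

/-- Evaluation at a point of `U`. -/
def evA (z : Fin n → ℂ) (hz : z ∈ U) : SmA U →ₐ[ℂ] ℂ :=
  (Pi.evalAlgHom ℂ (fun _ : U => ℂ) ⟨z, hz⟩).comp (SmA U).val

theorem ext_evA {a b : SmA U} (H : ∀ z hz, evA z hz a = evA z hz b) : a = b := by
  apply Subtype.ext
  funext ⟨z, hz⟩
  exact H z hz

/-- `F` agrees with `a` on `U`. -/
def RepA (F : (Fin n → ℂ) → ℂ) (a : SmA U) : Prop := ∀ z hz, F z = evA z hz a

/-- A smooth function as an element of the algebra. -/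
def mkA (F : (Fin n → ℂ) → ℂ) (hF : ContDiffOn ℝ (⊤ : ℕ∞) F U) : SmA U :=
  ⟨fun z => F z, hF.congr fun z hz => by simp [extU_apply _ hz]⟩

theorem rep_mkA (F : (Fin n → ℂ) → ℂ) (hF : ContDiffOn ℝ (⊤ : ℕ∞) F U) : RepA F (mkA F hF) :=
  fun _ _ => rfl

theorem rep_ext (a : SmA U) : RepA (extU U a.1) a := fun _ hz => extU_apply _ hz

theorem wdG_smooth (hU : IsOpen U) (c : ℂ) (k : Fin n) {F : (Fin n → ℂ) → ℂ}
    (hF : ContDiffOn ℝ (⊤ : ℕ∞) F U) : ContDiffOn ℝ (⊤ : ℕ∞) (wdG n c k F) U := by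
  have h1 : ContDiffOn ℝ (⊤ : ℕ∞) (fderiv ℝ F) U := hF.fderiv_of_isOpen hU (by simp)
  unfold wdG
  exact contDiffOn_const.mul ((h1.clm_apply contDiffOn_const).add
    (contDiffOn_const.mul (h1.clm_apply contDiffOn_const)))

theorem diffAt (hU : IsOpen U) {F : (Fin n → ℂ) → ℂ} (hF : ContDiffOn ℝ (⊤ : ℕ∞) F U)
    {z : Fin n → ℂ} (hz : z ∈ U) : DifferentiableAt ℝ F z :=
  (hF.contDiffAt (hU.mem_nhds hz)).differentiableAt (by simp)

theorem wdG_congr (hU : IsOpen U) (c : ℂ) (k : Fin n) {F G : (Fin n → ℂ) → ℂ}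
    (H : ∀ z ∈ U, F z = G z) {z : Fin n → ℂ} (hz : z ∈ U) : wdG n c k F z = wdG n c k G z := by
  have : F =ᶠ[nhds z] G := Filter.eventually_of_mem (hU.mem_nhds hz) H
  simp only [wdG, this.fderiv_eq]

theorem wdG_comm (hU : IsOpen U) (c d : ℂ) (k l : Fin n) {F : (Fin n → ℂ) → ℂ}
    (hF : ContDiffOn ℝ (⊤ : ℕ∞) F U) {z : Fin n → ℂ} (hz : z ∈ U) :
    wdG n c k (wdG n d l F) z = wdG n d l (wdG n c k F) z := by
  have h1 : ContDiffOn ℝ (⊤ : ℕ∞) (fderiv ℝ F) U := hF.fderiv_of_isOpen hU (by simp)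
  have h2 : DifferentiableAt ℝ (fderiv ℝ F) z :=
    (h1.contDiffAt (hU.mem_nhds hz)).differentiableAt (by simp)
  have sym : IsSymmSndFDerivAt ℝ F z := (hF.contDiffAt (hU.mem_nhds hz)).isSymmSndFDerivAt (by
    rw [minSmoothness_of_isRCLikeNormedField]
    exact WithTop.coe_le_coe.2 (le_top : (2 : ℕ∞) ≤ ⊤))
  have e : ∀ (d : ℂ) (l : Fin n) (v : Fin n → ℂ), fderiv ℝ (wdG n d l F) z v
      = (1 / 2 : ℂ) * (fderiv ℝ (fderiv ℝ F) z v (ebasis n l)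
        + d * fderiv ℝ (fderiv ℝ F) z v (Complex.I • ebasis n l)) := by
    intro d l v
    have hd : ∀ w : Fin n → ℂ, HasFDerivAt (fun y => fderiv ℝ F y w)
        ((fderiv ℝ (fderiv ℝ F) z).flip w) z := by
      intro w
      simpa using h2.hasFDerivAt.clm_apply (hasFDerivAt_const w z)
    have := (((hd (ebasis n l)).add ((hd (Complex.I • ebasis n l)).const_mul d)).const_mul
      (1 / 2 : ℂ)).fderiv
    have h3 : fderiv ℝ (wdG n d l F) z = _ := this
    rw [h3]
    simp
    ring
  simp only [wdG] at e ⊢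
  rw [e, e, e, e]
  rw [sym (ebasis n k) (ebasis n l), sym (ebasis n k) (Complex.I • ebasis n l),
    sym (Complex.I • ebasis n k) (ebasis n l),
    sym (Complex.I • ebasis n k) (Complex.I • ebasis n l)]
  ring

/-- The Wirtinger operators as derivations of the algebra of smooth functions. -/
def wdA (hU : IsOpen U) (c : ℂ) (k : Fin n) : Derivation ℂ (SmA U) (SmA U) :=
  Derivation.mk'
    { toFun := fun a => mkA (wdG n c k (extU U a.1)) (wdG_smooth hU c k a.2)
      map_add' := by
        intro a b
        apply ext_evA
        intro z hz
        have ha := diffAt hU a.2 hz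
        have hb := diffAt hU b.2 hz
        rw [map_add, ← rep_mkA _ _ z hz, ← rep_mkA _ _ z hz, ← rep_mkA _ _ z hz]
        rw [wdG_congr hU c k (G := extU U a.1 + extU U b.1) _ hz]
        · simp only [wdG, fderiv_add ha hb]
          simp only [ContinuousLinearMap.add_apply]
          ring
        · intro w hw
          simp [extU_apply _ hw]
      map_smul' := by
        intro r a
        apply ext_evA
        intro z hz
        have ha := diffAt hU a.2 hz
        rw [RingHom.id_apply, map_smul, ← rep_mkA _ _ z hz, ← rep_mkA _ _ z hz]
        rw [wdG_congr hU c k (G := fun w => r * extU U a.1 w) _ hz]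
        · simp only [wdG, fderiv_const_mul ha]
          simp only [ContinuousLinearMap.smul_apply, smul_eq_mul]
          ring
        · intro w hw
          simp [extU_apply _ hw] }
    (by
      intro a b
      apply ext_evA
      intro z hz
      have ha := diffAt hU a.2 hz
      have hb := diffAt hU b.2 hz
      simp only [LinearMap.coe_mk, AddHom.coe_mk, smul_eq_mul, map_add, map_mul]
      rw [← rep_mkA _ _ z hz, ← rep_mkA _ _ z hz, ← rep_mkA _ _ z hz]
      rw [wdG_congr hU c k (G := extU U a.1 * extU U b.1) _ hz]
      · rw [← rep_ext a z hz, ← rep_ext b z hz]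
        simp only [wdG, fderiv_mul ha hb]
        simp only [ContinuousLinearMap.add_apply, ContinuousLinearMap.smul_apply, smul_eq_mul]
        ring
      · intro w hw
        simp [extU_apply _ hw])

theorem rep_wdA (hU : IsOpen U) (c : ℂ) (k : Fin n) {F : (Fin n → ℂ) → ℂ} {a : SmA U}
    (H : RepA F a) : RepA (wdG n c k F) (wdA hU c k a) := by
  intro z hz
  rw [wdG_congr hU c k (G := extU U a.1) (fun w hw => (H w hw).trans (rep_ext a w hw).symm) hz]
  rfl

theorem wdA_comm (hU : IsOpen U) (c d : ℂ) (k l : Fin n) (a : SmA U) :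
    wdA hU c k (wdA hU d l a) = wdA hU d l (wdA hU c k a) := by
  apply ext_evA
  intro z hz
  rw [← rep_wdA hU c k (rep_wdA hU d l (rep_ext a)) z hz,
    ← rep_wdA hU d l (rep_wdA hU c k (rep_ext a)) z hz]
  exact wdG_comm hU c d k l a.2 hz

theorem rep_wdP (hU : IsOpen U) (k : Fin n) {F : (Fin n → ℂ) → ℂ} {a : SmA U}
    (H : RepA F a) : RepA (wdP n k F) (wdA hU (-Complex.I) k a) := by
  rw [wdP_eq]; exact rep_wdA hU _ k H

theorem rep_wdB (hU : IsOpen U) (k : Fin n) {F : (Fin n → ℂ) → ℂ} {a : SmA U}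
    (H : RepA F a) : RepA (wdB n k F) (wdA hU Complex.I k a) := by
  rw [wdB_eq]; exact rep_wdA hU _ k H

end Analysis
/-- third-order associativity identity: on `U`,
`C̃₃(φ,ψ)·χ + C₂(C₁(φ,ψ),χ) + C₁(C₂(φ,ψ),χ) + C̃₃(φψ,χ)
  = φ·C̃₃(ψ,χ) + C₂(φ,C₁(ψ,χ)) + C₁(φ,C₂(ψ,χ)) + C̃₃(φ,ψχ)`. -/
theorem stmt_2 (n : ℕ) (hn : 1 ≤ n) (U : Set (Fin n → ℂ)) (hU : IsOpen U)
    (Φ : (Fin n → ℂ) → ℝ) (hΦ : ContDiffOn ℝ (⊤ : ℕ∞) Φ U)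
    (ginv : Fin n → Fin n → (Fin n → ℂ) → ℂ)
    (hginv : ∀ l k : Fin n, ContDiffOn ℝ (⊤ : ℕ∞) (ginv l k) U)
    (hinv1 : ∀ z ∈ U, ∀ l q : Fin n,
      (∑ k, ginv l k z * gdn n Φ k q z) = if l = q then 1 else 0)
    (hinv2 : ∀ z ∈ U, ∀ p k : Fin n,
      (∑ l, gdn n Φ p l z * ginv l k z) = if p = k then 1 else 0) :
    ∀ φ ψ χ : (Fin n → ℂ) → ℂ,
      ContDiffOn ℝ (⊤ : ℕ∞) φ U → ContDiffOn ℝ (⊤ : ℕ∞) ψ U → ContDiffOn ℝ (⊤ : ℕ∞) χ U →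
      ∀ z ∈ U,
        C3top n Φ ginv φ ψ z * χ z + C2op n Φ ginv (C1op n ginv φ ψ) χ z
            + C1op n ginv (C2op n Φ ginv φ ψ) χ z
            + C3top n Φ ginv (fun w => φ w * ψ w) χ z
          = φ z * C3top n Φ ginv ψ χ z + C2op n Φ ginv φ (C1op n ginv ψ χ) z
            + C1op n ginv φ (C2op n Φ ginv ψ χ) z
            + C3top n Φ ginv φ (fun w => ψ w * χ w) z := by
  intro φ ψ χ hφ hψ hχ z hz
  have hΦc : ContDiffOn ℝ (⊤ : ℕ∞) (Phic n Φ) U :=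
    Complex.ofRealCLM.contDiff.comp_contDiffOn hΦ
  let ΦA : SmA U := mkA _ hΦc
  let h : Fin n → Fin n → SmA U := fun l k => mkA _ (hginv l k)
  let P : Fin n → Derivation ℂ (SmA U) (SmA U) := wdA hU (-Complex.I)
  let B : Fin n → Derivation ℂ (SmA U) (SmA U) := wdA hU Complex.I
  have hPP : ∀ i j f, P i (P j f) = P j (P i f) := fun i j f => wdA_comm hU _ _ i j f
  have hBB : ∀ i j f, B i (B j f) = B j (B i f) := fun i j f => wdA_comm hU _ _ i j f
  have hPB : ∀ i j f, P i (B j f) = B j (P i f) := fun i j f => wdA_comm hU _ _ i j f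
  have rP : ∀ (k : Fin n) {F : (Fin n → ℂ) → ℂ} {a : SmA U}, RepA F a → RepA (wdP n k F) (P k a) :=
    fun k _ _ H => rep_wdP hU k H
  have rB : ∀ (k : Fin n) {F : (Fin n → ℂ) → ℂ} {a : SmA U}, RepA F a → RepA (wdB n k F) (B k a) :=
    fun k _ _ H => rep_wdB hU k H
  have rΦ : RepA (Phic n Φ) ΦA := rep_mkA _ _
  have rh : ∀ l k, RepA (ginv l k) (h l k) := fun l k => rep_mkA _ _
  have rφ : RepA φ (mkA φ hφ) := rep_mkA _ _
  have rψ : RepA ψ (mkA ψ hψ) := rep_mkA _ _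
  have rχ : RepA χ (mkA χ hχ) := rep_mkA _ _
  clear_value P B ΦA h
  generalize mkA φ hφ = φA at rφ
  generalize mkA ψ hψ = ψA at rψ
  generalize mkA χ hχ = χA at rχ
  let g : Fin n → Fin n → SmA U := fun k l => P k (B l ΦA)
  have rg : ∀ k l, RepA (gdn n Φ k l) (g k l) := fun k l => rP k (rB l rΦ)
  have hg : ∀ l q, ∑ k, h l k * g k q = if l = q then 1 else 0 := by
    intro l q
    apply ext_evA
    intro w hw
    have := hinv1 w hw l q
    simp only [rh _ _ w hw, rg _ _ w hw] at this
    simp only [map_sum, map_mul]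
    rw [this]; split_ifs <;> simp
  have gh : ∀ l q, ∑ k, g l k * h k q = if l = q then 1 else 0 := by
    intro l q
    apply ext_evA
    intro w hw
    have := hinv2 w hw l q
    simp only [rh _ _ w hw, rg _ _ w hw] at this
    simp only [map_sum, map_mul]
    rw [this]; split_ifs <;> simp
  let ΓB : Fin n → Fin n → Fin n → SmA U := gamA B h g
  let ΓH : Fin n → Fin n → Fin n → SmA U := gamA P (fun k l => h l k) (fun l k => g k l)
  have hg' : ∀ l q, ∑ k, h k l * g q k = if l = q then 1 else 0 := by
    intro l q
    simp only [mul_comm (h _ l), gh, eq_comm]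
  have gh' : ∀ l q, ∑ k, g k l * h q k = if l = q then 1 else 0 := by
    intro l q
    simp only [mul_comm _ (h q _), hg, eq_comm]
  have hΓB : ∀ q l k, B q (h l k) = - ∑ a, ΓB l q a * h a k := fun q l k =>
    D_inv (B q) h g hg gh l k
  have hΓH : ∀ q l k, P q (h k l) = - ∑ a, ΓH l q a * h k a := fun q l k =>
    D_inv (P q) (fun k l => h l k) (fun l k => g k l) hg' gh' l k
  have sB : ∀ a l q, ΓB a l q = ΓB a q l := by
    intro a l q
    refine Finset.sum_congr rfl fun s _ => ?_
    simp only [g]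
    rw [← hPB, ← hPB, hBB]
  have sH : ∀ a l q, ΓH a l q = ΓH a q l := by
    intro a l q
    refine Finset.sum_congr rfl fun s _ => ?_
    simp only [g]
    rw [hPP]
  have flatB := gamA_flat B h g hBB hΓB
  have flatH := gamA_flat P (fun k l => h l k) (fun l k => g k l) hPP hΓH
  let R : Fin n → Fin n → Fin n → Fin n → SmA U := fun q p k l =>
    P k (B l (h q p)) - ∑ m, ∑ m', B l (h q m) * P k (h m' p) * g m m'
  have RB : ∀ q p k l, R q p k l = - ∑ c, P k (ΓB q l c) * h c p := fun q p k l =>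
    curv_gam B h ΓB g (P k) hg hΓB q p l
  have RH : ∀ q p k l, R q p k l = - ∑ c, B l (ΓH p k c) * h q c := by
    intro q p k l
    rw [← curv_gam P (fun k l => h l k) ΓH (fun l k => g k l) (B l) hg' hΓH p q k]
    simp only [R]
    rw [hPB, Finset.sum_comm]
    congr 1
    exact Finset.sum_congr rfl fun _ _ => Finset.sum_congr rfl fun _ _ => by ring
  let S : Fin n → Fin n → SmA U := fun l k => ∑ m, ∑ m', ∑ p, ∑ q,
        h m' m * R l p m q * R q k p m'
  have main := assoc3 P B h ΓB ΓH R S hPP hBB hPB sB sH flatB flatH hΓB hΓH RB RH φA ψA χA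
  -- translation
  have rΓB : ∀ t l q, RepA (GamB n Φ ginv t l q) (ΓB t l q) := by
    intro t l q w hw
    simp only [GamB, ΓB, gamA, map_sum, map_mul]
    refine Finset.sum_congr rfl fun s _ => ?_
    rw [← rh _ _ w hw]
    simp only [g]
    rw [← hPB, hBB l q, ← rP s (rB q (rB l rΦ)) w hw]
    rfl
  have rΓH : ∀ t l q, RepA (GamH n Φ ginv t l q) (ΓH t l q) := by
    intro t l q w hw
    simp only [GamH, ΓH, gamA, map_sum, map_mul]
    refine Finset.sum_congr rfl fun s _ => ?_
    rw [← rh _ _ w hw, mul_comm]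
    simp only [g]
    rw [← rP l (rP q (rB s rΦ)) w hw]
    rfl
  have rR : ∀ q p k l, RepA (Rcur n Φ ginv q p k l) (R q p k l) := by
    intro q p k l w hw
    simp only [Rcur, R, map_sum, map_mul, map_sub, rP _ (rB _ (rh _ _)) w hw, rB _ (rh _ _) w hw,
      rP _ (rh _ _) w hw, rg _ _ w hw]
  clear_value ΓB ΓH R g
  have rB2 : ∀ {F : (Fin n → ℂ) → ℂ} {a : SmA U}, RepA F a → ∀ l q,
      RepA (cdB2 n Φ ginv F l q) (cov2 B ΓB a l q) := by
    intro F a H l q w hw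
    simp only [cdB2, cov2, map_sub, map_sum, map_mul, rB _ (rB _ H) w hw, rB _ H w hw,
      rΓB _ _ _ w hw]
  have rH2 : ∀ {F : (Fin n → ℂ) → ℂ} {a : SmA U}, RepA F a → ∀ l q,
      RepA (cdH2 n Φ ginv F l q) (cov2 P ΓH a l q) := by
    intro F a H l q w hw
    simp only [cdH2, cov2, map_sub, map_sum, map_mul, rP _ (rP _ H) w hw, rP _ H w hw,
      rΓH _ _ _ w hw]
  have rB3 : ∀ {F : (Fin n → ℂ) → ℂ} {a : SmA U}, RepA F a → ∀ l q t,
      RepA (cdB3 n Φ ginv F l q t) (cov3 B ΓB a l q t) := by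
    intro F a H l q t w hw
    simp only [cdB3, cov3, map_sub, map_sum, map_mul, rB _ (rB2 H _ _) w hw, rB2 H _ _ w hw,
      rΓB _ _ _ w hw]
  have rH3 : ∀ {F : (Fin n → ℂ) → ℂ} {a : SmA U}, RepA F a → ∀ l q t,
      RepA (cdH3 n Φ ginv F l q t) (cov3 P ΓH a l q t) := by
    intro F a H l q t w hw
    simp only [cdH3, cov3, map_sub, map_sum, map_mul, rP _ (rH2 H _ _) w hw, rH2 H _ _ w hw,
      rΓH _ _ _ w hw]
  have rC1 : ∀ {F G : (Fin n → ℂ) → ℂ} {a b : SmA U}, RepA F a → RepA G b →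
      RepA (C1op n ginv F G) (C1A P B h a b) := by
    intro F G a b H K w hw
    simp only [C1op, C1A, map_sum, map_mul, rh _ _ w hw, rB _ H w hw, rP _ K w hw, mul_assoc]
  have rC2 : ∀ {F G : (Fin n → ℂ) → ℂ} {a b : SmA U}, RepA F a → RepA G b →
      RepA (C2op n Φ ginv F G) (algebraMap ℂ (SmA U) (1 / 2) * C2A P B h ΓB ΓH a b) := by
    intro F G a b H K w hw
    simp only [C2op, C2A, T2, map_sum, map_mul, AlgHom.commutes, rh _ _ w hw, rB2 H _ _ w hw,
      rH2 K _ _ w hw, mul_assoc]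
    rfl
  have rC3 : ∀ {F G : (Fin n → ℂ) → ℂ} {a b : SmA U}, RepA F a → RepA G b →
      RepA (C3top n Φ ginv F G) (C3A P B h ΓB ΓH R S a b) := by
    intro F G a b H K w hw
    simp only [C3top, C3A, M3A, KA, SA, S, T3, Rup4, map_sum, map_mul, map_add, AlgHom.commutes,
      rh _ _ w hw, rB2 H _ _ w hw, rH2 K _ _ w hw, rB3 H _ _ _ w hw, rH3 K _ _ _ w hw,
      rB _ H w hw, rP _ K w hw, rR _ _ _ _ w hw, mul_assoc]
    rfl
  have rmul : ∀ {F G : (Fin n → ℂ) → ℂ} {a b : SmA U}, RepA F a → RepA G b →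
      RepA (fun w => F w * G w) (a * b) := by
    intro F G a b H K w hw
    simp only [map_mul, H w hw, K w hw]
  have fin := congrArg (evA z hz) main
  rw [map_add, map_add, map_add, map_add, map_add, map_add, map_mul _ (C3A P B h ΓB ΓH R S φA ψA),
    map_mul _ φA (C3A P B h ΓB ΓH R S ψA χA)] at fin
  rw [← rC3 rφ rψ z hz, ← rC3 rψ rχ z hz, ← rC3 (rmul rφ rψ) rχ z hz,
    ← rC3 rφ (rmul rψ rχ) z hz, ← rC2 (rC1 rφ rψ) rχ z hz, ← rC2 rφ (rC1 rψ rχ) z hz,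
    ← rC1 (rC2 rφ rψ) rχ z hz, ← rC1 rφ (rC2 rψ rχ) z hz, ← rφ z hz, ← rχ z hz] at fin
  exact fin
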